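/- Let a and b be coprime integers with 2 ≤ a < b, a odd, and d := a·b not a perfect square. Let T be the minimal period of the continued fraction of √d and (u_n), (v_n) the associated sequences. Assume T ≡ 0 (mod 4) and set N = T/2. Then the equation a·x² − b·y² = 1 has a solution (x, y) ∈ ℕ² if and only if v_N = a. -/

import Mathlib

/-- The complete quotients of a real number `x`:
`cq x 0 = x` and `cq x (n+1) = 1 / (cq x n - ⌊cq x n⌋)`. -/
noncomputable def cq (x : ℝ) : ℕ → ℝ
  | 0 => x
  | n + 1 => (Int.fract (cq x n))⁻¹

/-- The partial quotients of a real number `x`: `pq x n = ⌊cq x n⌋`. -/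
noncomputable def pq (x : ℝ) (n : ℕ) : ℤ := ⌊cq x n⌋

theorem cq_cq (x : ℝ) (m n : ℕ) : cq (cq x m) n = cq x (m + n) := by
  induction n with
  | zero => rfl
  | succ n ih => rw [← add_assoc, cq, cq, ih]

theorem fract_mul_fract_inv_le {x : ℝ} (h : 0 < Int.fract x) :
    Int.fract x * Int.fract (Int.fract x)⁻¹ ≤ 1 / 2 := by
  have h1 : (1 : ℝ) ≤ ⌊(Int.fract x)⁻¹⌋ := by
    exact_mod_cast Int.le_floor.2 (by simpa using (one_le_inv₀ h).2 (Int.fract_lt_one x).le)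
  have h2 := Int.floor_add_fract (Int.fract x)⁻¹
  have h3 := Int.fract_lt_one (Int.fract x)⁻¹
  have h4 : Int.fract x * (⌊(Int.fract x)⁻¹⌋ + Int.fract (Int.fract x)⁻¹) = 1 := by
    rw [h2, mul_inv_cancel₀ h.ne']
  nlinarith

/-- A real number with an infinite continued fraction is determined by its partial quotients. -/
theorem eq_of_pq_eq {x y : ℝ} (hx : ∀ n, 0 < Int.fract (cq x n))
    (hy : ∀ n, 0 < Int.fract (cq y n)) (h : ∀ n, pq x n = pq y n) : x = y := by
  have hfr : ∀ n, cq x n - cq y n = Int.fract (cq x n) - Int.fract (cq y n) := fun n ↦ by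
    have h1 := Int.floor_add_fract (cq x n)
    have h2 := Int.floor_add_fract (cq y n)
    have h3 : ⌊cq x n⌋ = ⌊cq y n⌋ := h n
    rw [h3] at h1
    linarith
  have hstep : ∀ n, |cq x n - cq y n| =
      Int.fract (cq x n) * Int.fract (cq y n) * |cq x (n + 1) - cq y (n + 1)| := fun n ↦ by
    rw [hfr n, cq, cq, ← abs_of_pos (mul_pos (hx n) (hy n)), ← abs_mul, abs_sub_comm]
    have := (hx n).ne'
    have := (hy n).ne'
    congr 1
    field_simp
  have hstep2 : ∀ n, |cq x n - cq y n| ≤ 1 / 4 * |cq x (n + 2) - cq y (n + 2)| := fun n ↦ by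
    have h1 : Int.fract (cq x n) * Int.fract (cq x (n + 1)) ≤ 1 / 2 :=
      fract_mul_fract_inv_le (hx n)
    have h2 : Int.fract (cq y n) * Int.fract (cq y (n + 1)) ≤ 1 / 2 :=
      fract_mul_fract_inv_le (hy n)
    have h3 := mul_le_mul h1 h2 (mul_pos (hy n) (hy (n + 1))).le (by norm_num)
    have h4 := mul_le_mul_of_nonneg_right h3 (abs_nonneg (cq x (n + 2) - cq y (n + 2)))
    rw [hstep n, hstep (n + 1)]
    calc _ = Int.fract (cq x n) * Int.fract (cq x (n + 1)) *
          (Int.fract (cq y n) * Int.fract (cq y (n + 1))) *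
          |cq x (n + 2) - cq y (n + 2)| := by ring
      _ ≤ _ := h4
      _ = _ := by norm_num
  have hpow : ∀ n, |x - y| ≤ (1 / 4) ^ n * |cq x (2 * n) - cq y (2 * n)| := fun n ↦ by
    induction n with
    | zero => simp [cq]
    | succ n ih =>
      have := mul_le_mul_of_nonneg_left (hstep2 (2 * n)) (show (0 : ℝ) ≤ (1 / 4) ^ n by positivity)
      rw [show 2 * (n + 1) = 2 * n + 2 by ring, pow_succ]
      linarith
  by_contra hne
  obtain ⟨n, hn⟩ := exists_pow_lt_of_lt_one (abs_pos.2 (sub_ne_zero.2 hne))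
    (show (1 / 4 : ℝ) < 1 by norm_num)
  have hlt : |cq x (2 * n) - cq y (2 * n)| ≤ 1 := by
    rw [hfr, abs_le]
    constructor <;>
    linarith [Int.fract_lt_one (cq x (2 * n)), Int.fract_lt_one (cq y (2 * n)),
      hx (2 * n), hy (2 * n)]
  have := mul_le_mul_of_nonneg_left hlt (show (0 : ℝ) ≤ (1 / 4) ^ n by positivity)
  linarith [hpow n]

/-- Numerators of the convergents of `x`, shifted by one: `cfNum x (n + 1) / cfDen x (n + 1)` is
the `n`-th convergent. -/
noncomputable def cfNum (x : ℝ) : ℕ → ℤ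
  | 0 => 1
  | 1 => pq x 0
  | n + 2 => pq x (n + 1) * cfNum x (n + 1) + cfNum x n

/-- Denominators of the convergents of `x`, shifted by one. -/
noncomputable def cfDen (x : ℝ) : ℕ → ℤ
  | 0 => 0
  | 1 => 1
  | n + 2 => pq x (n + 1) * cfDen x (n + 1) + cfDen x n

theorem cfNum_mul_cfDen_sub (x : ℝ) (n : ℕ) :
    cfNum x (n + 1) * cfDen x n - cfNum x n * cfDen x (n + 1) = (-1) ^ (n + 1) := by
  induction n with
  | zero => simp [cfNum, cfDen]
  | succ n ih =>
    rw [cfNum, cfDen, pow_succ, ← ih]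
    ring

theorem isCoprime_cfNum_cfDen (x : ℝ) (n : ℕ) : IsCoprime (cfNum x n) (cfDen x n) := by
  have h := cfNum_mul_cfDen_sub x n
  rcases neg_one_pow_eq_or ℤ (n + 1) with h1 | h1 <;> rw [h1] at h
  · exact ⟨-cfDen x (n + 1), cfNum x (n + 1), by linarith⟩
  · exact ⟨cfDen x (n + 1), -cfNum x (n + 1), by linarith⟩

theorem cfDen_nonneg {x : ℝ} (h : ∀ n, 1 ≤ pq x (n + 1)) (n : ℕ) :
    0 ≤ cfDen x n ∧ 0 < cfDen x (n + 1) := by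
  induction n with
  | zero => simp [cfDen]
  | succ n ih =>
    refine ⟨ih.2.le, ?_⟩
    rw [cfDen]
    nlinarith [h n, ih.1, ih.2]

theorem convergent_cq_pos {x : ℝ} (h : ∀ n, 1 ≤ pq x (n + 1)) (n m : ℕ) :
    0 < (cq x (m + 1)).convergent n := by
  have hm : ∀ m, (1 : ℚ) ≤ ⌊cq x (m + 1)⌋ := fun m ↦ by exact_mod_cast h m
  induction n generalizing m with
  | zero => rw [Real.convergent_zero]; linarith [hm m]
  | succ n ih =>
    rw [Real.convergent_succ]
    have := inv_pos.2 (ih (m + 1))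
    rw [cq] at this
    linarith [hm m]

theorem convergent_add {x : ℝ} (h : ∀ n, 1 ≤ pq x (n + 1)) (m n : ℕ) :
    x.convergent (m + 1 + n) =
      (cfNum x (m + 1) * (cq x (m + 1)).convergent n + cfNum x m) /
        (cfDen x (m + 1) * (cq x (m + 1)).convergent n + cfDen x m) := by
  induction m generalizing n with
  | zero =>
    have hc := (convergent_cq_pos h n 0).ne'
    rw [show 0 + 1 + n = n + 1 by ring, Real.convergent_succ]
    rw [cq, cq] at *
    simp only [cfNum, cfDen, pq, cq]
    push_cast
    rw [eq_div_iff (by simpa using hc), one_mul, add_zero, add_mul, inv_mul_cancel₀ hc]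
  | succ m ih =>
    have hc := convergent_cq_pos h n (m + 1)
    rw [show m + 1 + 1 + n = m + 1 + (n + 1) by ring, ih (n + 1), Real.convergent_succ,
      ← cq, cfNum, cfDen, pq]
    have h1 : (0 : ℚ) ≤ cfDen x m := by exact_mod_cast (cfDen_nonneg h m).1
    have h2 : (0 : ℚ) < cfDen x (m + 1) := by exact_mod_cast (cfDen_nonneg h m).2
    have h3 : (1 : ℚ) ≤ ⌊cq x (m + 1)⌋ := by exact_mod_cast h m
    push_cast
    have hc' := hc.ne'
    set c := (cq x (m + 1 + 1)).convergent n
    have h4 : 0 < (⌊cq x (m + 1)⌋ * cfDen x (m + 1) + cfDen x m) * c + cfDen x (m + 1) := by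
      positivity
    have h5 : 0 < cfDen x (m + 1) * (⌊cq x (m + 1)⌋ + c⁻¹) + cfDen x m := by
      positivity
    rw [div_eq_div_iff h5.ne' h4.ne']
    field_simp
    ring

theorem convergent_eq_cfNum_div_cfDen {x : ℝ} (h : ∀ n, 1 ≤ pq x (n + 1)) (n : ℕ) :
    x.convergent n = cfNum x (n + 1) / cfDen x (n + 1) := by
  cases n with
  | zero => simp [cfNum, cfDen, pq, cq]
  | succ n =>
    have := convergent_add h n 0
    rw [Real.convergent_zero] at this
    rw [← add_zero (n + 1), this, add_zero, cfNum, cfDen, pq]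
    push_cast
    ring

/-- The integer sequences produced by the continued fraction algorithm for `√d`; the complete
quotients are `(√d + u n) / v n` for `n ≥ 1`. -/
structure SqrtExpansion (d : ℕ) (c u v : ℕ → ℤ) : Prop where
  not_isSquare : ¬ IsSquare d
  c_zero : c 0 = 2 * pq (Real.sqrt d) 0
  c_succ : ∀ n, c (n + 1) = pq (Real.sqrt d) (n + 1)
  u_zero : u 0 = pq (Real.sqrt d) 0
  v_zero : v 0 = 1
  v_pos : ∀ n, 0 < v n
  u_succ : ∀ n, u (n + 1) = c n * v n - u n
  v_mul_v_succ : ∀ n, v n * v (n + 1) = (d : ℤ) - u (n + 1) ^ 2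

namespace SqrtExpansion

variable {d : ℕ} {c u v : ℕ → ℤ}

theorem irrational (E : SqrtExpansion d c u v) : Irrational (Real.sqrt d) :=
  irrational_sqrt_natCast_iff.2 E.not_isSquare

theorem u_one (E : SqrtExpansion d c u v) : u 1 = pq (Real.sqrt d) 0 := by
  rw [E.u_succ 0, E.c_zero, E.v_zero, E.u_zero]
  ring

theorem v_mul_v_succ_real (E : SqrtExpansion d c u v) (n : ℕ) :
    (v n : ℝ) * v (n + 1) = (Real.sqrt d - u (n + 1)) * (Real.sqrt d + u (n + 1)) := by
  have h : (v n : ℝ) * v (n + 1) = d - (u (n + 1) : ℝ) ^ 2 := by exact_mod_cast E.v_mul_v_succ n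
  rw [h]
  nth_rw 1 [← Real.sq_sqrt (Nat.cast_nonneg d)]
  ring

theorem sqrt_sub_ne_zero (E : SqrtExpansion d c u v) (n : ℕ) : Real.sqrt d - u n ≠ 0 :=
  sub_ne_zero.2 (E.irrational.ne_int _)

theorem inv_eq (E : SqrtExpansion d c u v) (n : ℕ) :
    ((Real.sqrt d - u (n + 1)) / v n)⁻¹ = (Real.sqrt d + u (n + 1)) / v (n + 1) := by
  have h1 : (v (n + 1) : ℝ) ≠ 0 := by exact_mod_cast (E.v_pos (n + 1)).ne'
  rw [inv_div, div_eq_div_iff (E.sqrt_sub_ne_zero _) h1, E.v_mul_v_succ_real]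
  ring

theorem fract_eq_of_cq_eq (E : SqrtExpansion d c u v) {n : ℕ}
    (h : cq (Real.sqrt d) (n + 1) = (Real.sqrt d + u (n + 1)) / v (n + 1)) :
    Int.fract (cq (Real.sqrt d) (n + 1)) = (Real.sqrt d - u (n + 2)) / v (n + 1) := by
  have h1 : (v (n + 1) : ℝ) ≠ 0 := by exact_mod_cast (E.v_pos (n + 1)).ne'
  rw [Int.fract, ← pq, ← E.c_succ, h, E.u_succ (n + 1)]
  push_cast
  field_simp
  ring

theorem fract_cq_zero (E : SqrtExpansion d c u v) :
    Int.fract (cq (Real.sqrt d) 0) = (Real.sqrt d - u 1) / v 0 := by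
  rw [Int.fract, ← pq, E.u_one, E.v_zero, cq]
  simp

theorem cq_succ (E : SqrtExpansion d c u v) (n : ℕ) :
    cq (Real.sqrt d) (n + 1) = (Real.sqrt d + u (n + 1)) / v (n + 1) := by
  induction n with
  | zero => rw [cq, E.fract_cq_zero, E.inv_eq]
  | succ n ih => rw [cq, E.fract_eq_of_cq_eq ih, E.inv_eq]

theorem fract_cq (E : SqrtExpansion d c u v) (n : ℕ) :
    Int.fract (cq (Real.sqrt d) n) = (Real.sqrt d - u (n + 1)) / v n := by
  cases n with
  | zero => exact E.fract_cq_zero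
  | succ n => exact E.fract_eq_of_cq_eq (E.cq_succ n)

theorem fract_cq_pos (E : SqrtExpansion d c u v) (n : ℕ) :
    0 < Int.fract (cq (Real.sqrt d) n) := by
  refine lt_of_le_of_ne (Int.fract_nonneg _) (Ne.symm ?_)
  rw [E.fract_cq]
  exact div_ne_zero (E.sqrt_sub_ne_zero _) (by exact_mod_cast (E.v_pos n).ne')

theorem one_le_pq_succ (E : SqrtExpansion d c u v) (n : ℕ) : 1 ≤ pq (Real.sqrt d) (n + 1) := by
  rw [pq, Int.le_floor, cq]
  simpa using (one_le_inv₀ (E.fract_cq_pos n)).2 (Int.fract_lt_one _).le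

theorem one_le_sqrt (E : SqrtExpansion d c u v) : 1 ≤ Real.sqrt d := by
  have : d ≠ 0 := by
    rintro rfl
    exact E.not_isSquare (IsSquare.zero)
  rw [Real.one_le_sqrt]
  exact_mod_cast Nat.one_le_iff_ne_zero.2 this

theorem one_le_c (E : SqrtExpansion d c u v) (n : ℕ) : 1 ≤ c n := by
  cases n with
  | zero =>
    have : 1 ≤ pq (Real.sqrt d) 0 := by
      rw [pq, Int.le_floor, cq]
      simpa using E.one_le_sqrt
    rw [E.c_zero]
    linarith
  | succ n => rw [E.c_succ]; exact E.one_le_pq_succ n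

theorem u_succ_window (E : SqrtExpansion d c u v) (n : ℕ) :
    0 < Real.sqrt d - u (n + 1) ∧ Real.sqrt d - u (n + 1) < v n := by
  have hv : (0 : ℝ) < v n := by exact_mod_cast E.v_pos n
  have h1 := E.fract_cq_pos n
  have h2 := Int.fract_lt_one (cq (Real.sqrt d) n)
  rw [E.fract_cq] at h1 h2
  exact ⟨by simpa using (lt_div_iff₀ hv).1 h1, by simpa using (div_lt_iff₀ hv).1 h2⟩

theorem u_window (E : SqrtExpansion d c u v) (n : ℕ) :
    0 < Real.sqrt d - u n ∧ Real.sqrt d - u n < v n := by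
  cases n with
  | zero =>
    have := E.u_succ_window 0
    rwa [E.u_one, ← E.u_zero] at this
  | succ n =>
    have h0 := E.u_succ_window n
    refine ⟨h0.1, ?_⟩
    have hn : Real.sqrt d - u n > 0 := by
      cases n with
      | zero =>
        have := E.u_succ_window 0
        rw [E.u_one, ← E.u_zero] at this
        exact this.1
      | succ n => exact (E.u_succ_window n).1
    have hv : (0 : ℝ) < v n := by exact_mod_cast E.v_pos n
    have hc : (1 : ℝ) ≤ c n := by exact_mod_cast E.one_le_c n
    have h1 : (v n : ℝ) < Real.sqrt d + u (n + 1) := by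
      rw [E.u_succ]
      push_cast
      nlinarith
    have h2 := E.v_mul_v_succ_real n
    nlinarith [h0.1]

/-- Two integers in the window `(√d - w, √d)` congruent modulo `w` are equal. -/
theorem eq_of_window {s : ℝ} {w x y : ℤ} (hx : 0 < s - x ∧ s - x < w)
    (hy : 0 < s - y ∧ s - y < w) (h : w ∣ x - y) : x = y := by
  have : |x - y| < w := by
    rw [abs_lt]
    constructor <;> rify <;> linarith [hx.1, hx.2, hy.1, hy.2]
  exact sub_eq_zero.1 (Int.eq_zero_of_abs_lt_dvd h this)

/-- The expansion is symmetric about any index where `u` is stationary. -/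
theorem reflect (E : SqrtExpansion d c u v) {m : ℕ} (hm : u (m + 1) = u m) (i j : ℕ)
    (hij : i + j = m) : v (m + i) = v j ∧ u (m + i + 1) = u j := by
  induction i generalizing j with
  | zero =>
    obtain rfl : j = m := by omega
    exact ⟨rfl, hm⟩
  | succ i ih =>
    obtain ⟨h1, h2⟩ := ih (j + 1) (by omega)
    have h3 := E.v_mul_v_succ (m + i)
    have h4 := E.v_mul_v_succ j
    have hv : v (m + i + 1) = v j := by
      rw [h2, h1] at h3
      exact mul_left_cancel₀ (E.v_pos (j + 1)).ne' (by rw [h3, ← h4, mul_comm])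
    refine ⟨hv, ?_⟩
    have h5 := E.u_succ_window (m + i + 1)
    rw [hv] at h5
    refine eq_of_window h5 (E.u_window j) ⟨c (m + i + 1) - c j, ?_⟩
    rw [← add_assoc, E.u_succ (m + i + 1), h2, hv, E.u_succ j]
    ring

theorem u_succ_eq_of_dvd (E : SqrtExpansion d c u v) {n : ℕ} (h : v n ∣ u n) :
    u (n + 1) = u n := by
  refine eq_of_window (E.u_succ_window n) (E.u_window n) ?_
  rw [E.u_succ]
  exact dvd_sub (dvd_sub (dvd_mul_left _ _) h) h

theorem u_eq_of_v_eq_one (E : SqrtExpansion d c u v) {n : ℕ} (h : v n = 1) : u n = u 0 := by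
  have h1 := E.u_window n
  have h2 := E.u_window 0
  rw [E.v_zero] at h2
  rw [h] at h1
  exact eq_of_window h1 h2 (one_dvd _)

theorem cq_add_of_v_eq_one (E : SqrtExpansion d c u v) {m : ℕ} (h : v m = 1) (n : ℕ) :
    cq (Real.sqrt d) (n + 1 + m) = cq (Real.sqrt d) (n + 1) := by
  have h1 : u (m + 1) = u 1 := by
    rw [E.u_succ_eq_of_dvd (by rw [h]; exact one_dvd _), E.u_eq_of_v_eq_one h, E.u_one, E.u_zero]
  have h2 := E.v_mul_v_succ m
  have h3 := E.v_mul_v_succ 0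
  rw [h, one_mul, h1] at h2
  rw [E.v_zero, one_mul, zero_add, ← h2] at h3
  have h4 : cq (Real.sqrt d) (m + 1) = cq (Real.sqrt d) 1 := by
    rw [E.cq_succ, E.cq_succ 0, h1, ← h3]
  rw [show n + 1 + m = m + 1 + n by ring, ← cq_cq, h4, cq_cq, add_comm]

theorem period_add (E : SqrtExpansion d c u v) {T : ℕ}
    (hper : ∀ n, 1 ≤ n → pq (Real.sqrt d) (n + T) = pq (Real.sqrt d) n) (n : ℕ) :
    v (n + T) = v n ∧ u (n + T + 1) = u (n + 1) := by
  have hcq : cq (Real.sqrt d) 1 = cq (Real.sqrt d) (1 + T) := by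
    refine eq_of_pq_eq (fun n ↦ ?_) (fun n ↦ ?_) (fun n ↦ ?_)
    · rw [cq_cq]; exact E.fract_cq_pos _
    · rw [cq_cq]; exact E.fract_cq_pos _
    · rw [pq, pq, cq_cq, cq_cq, ← pq, ← pq, ← hper (1 + n) (by omega)]
      congr 1
      ring
  have huv : ∀ n, v (n + 1 + T) = v (n + 1) ∧ u (n + 1 + T) = u (n + 1) := fun n ↦ by
    have h1 : cq (Real.sqrt d) (n + T + 1) = cq (Real.sqrt d) (n + 1) := by
      rw [show n + T + 1 = 1 + T + n by ring, ← cq_cq, ← hcq, cq_cq, add_comm]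
    rw [E.cq_succ, E.cq_succ] at h1
    rw [show n + 1 + T = n + T + 1 by ring]
    have p1 : (v (n + 1) : ℝ) ≠ 0 := by exact_mod_cast (E.v_pos (n + 1)).ne'
    have p2 : (v (n + T + 1) : ℝ) ≠ 0 := by exact_mod_cast (E.v_pos (n + T + 1)).ne'
    rw [div_eq_div_iff p2 p1] at h1
    have hv : v (n + T + 1) = v (n + 1) := by
      by_contra hne
      have hne' : v (n + 1) - v (n + T + 1) ≠ 0 := fun h ↦ hne (by linarith)
      refine (Irrational.mul_intCast E.irrational hne').ne_int
        (u (n + 1) * v (n + T + 1) - u (n + T + 1) * v (n + 1)) ?_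
      push_cast
      linarith
    refine ⟨hv, ?_⟩
    rw [hv] at h1
    have := mul_right_cancel₀ p1 h1
    exact_mod_cast add_left_cancel this
  refine ⟨?_, ?_⟩
  · cases n with
    | zero =>
      have h1 := E.v_mul_v_succ T
      have h2 := E.v_mul_v_succ 0
      have h3 := huv 0
      rw [show T + 1 = 0 + 1 + T by ring, h3.1, h3.2, ← h2] at h1
      rw [zero_add]
      exact mul_right_cancel₀ (E.v_pos _).ne' h1
    | succ n => exact (huv n).1
  · rw [show n + T + 1 = n + 1 + T by ring]
    exact (huv n).2

theorem v_add_mul_period (E : SqrtExpansion d c u v) {T : ℕ}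
    (hper : ∀ n, 1 ≤ n → pq (Real.sqrt d) (n + T) = pq (Real.sqrt d) n) (n k : ℕ) :
    v (n + k * T) = v n := by
  induction k with
  | zero => simp
  | succ k ih => rw [← ih, ← (E.period_add hper (n + k * T)).1]; congr 1; ring

theorem period_dvd_of_v_eq_one (E : SqrtExpansion d c u v) {T : ℕ} (hT : 1 ≤ T)
    (hper : ∀ n, 1 ≤ n → pq (Real.sqrt d) (n + T) = pq (Real.sqrt d) n)
    (hmin : ∀ T', 1 ≤ T' →
      (∀ n, 1 ≤ n → pq (Real.sqrt d) (n + T') = pq (Real.sqrt d) n) → T ≤ T')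
    {m : ℕ} (h : v m = 1) : T ∣ m := by
  have hr : v (m % T) = 1 := by
    rw [← E.v_add_mul_period hper (m % T) (m / T), mul_comm, Nat.mod_add_div, h]
  rcases Nat.eq_zero_or_pos (m % T) with h0 | h0
  · exact Nat.dvd_of_mod_eq_zero h0
  · refine absurd (hmin _ h0 fun n hn ↦ ?_) (not_le.2 (Nat.mod_lt _ hT))
    obtain ⟨k, rfl⟩ := Nat.exists_eq_add_of_le' hn
    rw [pq, pq, E.cq_add_of_v_eq_one hr]

/-- The expansion is symmetric about half of an even period. -/
theorem u_half_period_succ (E : SqrtExpansion d c u v) {N : ℕ}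
    (hper : ∀ n, 1 ≤ n → pq (Real.sqrt d) (n + (N + N)) = pq (Real.sqrt d) n) :
    u (N + 1) = u N := by
  have h1 : v (N + N) = 1 := by
    have := (E.period_add hper 0).1
    rwa [zero_add, E.v_zero] at this
  have h2 := E.u_succ_eq_of_dvd (n := N + N) (by rw [h1]; exact one_dvd _)
  rw [← (E.period_add hper N).2, ← (E.reflect h2 N N rfl).2, add_comm N (N + N)]

theorem cfNum_cfDen (E : SqrtExpansion d c u v) (n : ℕ) :
    cfNum (Real.sqrt d) (n + 1) =
      u (n + 1) * cfDen (Real.sqrt d) (n + 1) + v (n + 1) * cfDen (Real.sqrt d) n ∧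
    d * cfDen (Real.sqrt d) (n + 1) =
      u (n + 1) * cfNum (Real.sqrt d) (n + 1) + v (n + 1) * cfNum (Real.sqrt d) n := by
  induction n with
  | zero =>
    have := E.v_mul_v_succ 0
    rw [E.v_zero, one_mul, zero_add, E.u_one] at this
    simp only [cfNum, cfDen, zero_add, E.u_one]
    exact ⟨by ring, by rw [this]; ring⟩
  | succ n ih =>
    have h1 := E.v_mul_v_succ (n + 1)
    have h2 := E.u_succ (n + 1)
    rw [E.c_succ] at h2
    have hd : (d : ℤ) = v (n + 1) * v (n + 1 + 1) + u (n + 1 + 1) ^ 2 := by linarith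
    have hv := (E.v_pos (n + 1)).ne'
    obtain ⟨i1, i2⟩ := ih
    simp only [cfNum, cfDen]
    generalize cfNum (Real.sqrt d) (n + 1) = P at *
    generalize cfDen (Real.sqrt d) (n + 1) = Q at *
    generalize cfNum (Real.sqrt d) n = P' at *
    generalize cfDen (Real.sqrt d) n = Q' at *
    generalize pq (Real.sqrt d) (n + 1) = A at *
    constructor
    · apply mul_left_cancel₀ hv
      grind
    · apply mul_left_cancel₀ hv
      grind

theorem norm_eq (E : SqrtExpansion d c u v) (n : ℕ) :
    cfNum (Real.sqrt d) n ^ 2 - d * cfDen (Real.sqrt d) n ^ 2 = (-1) ^ n * v n := by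
  cases n with
  | zero => simp [cfNum, cfDen, E.v_zero]
  | succ n =>
    obtain ⟨h1, h2⟩ := E.cfNum_cfDen n
    rw [← cfNum_mul_cfDen_sub (Real.sqrt d) n]
    linear_combination (cfNum (Real.sqrt d) (n + 1)) * h1 - (cfDen (Real.sqrt d) (n + 1)) * h2

/-- Coprime solutions of `p ^ 2 - d * q ^ 2 = w` with `0 < w < √d` come from convergents. -/
theorem exists_eq_cfNum_cfDen (E : SqrtExpansion d c u v) {p q w : ℤ} (hp : 0 < p) (hq : 0 < q)
    (hcop : IsCoprime p q) (hw : 0 < w) (hwd : w ^ 2 < d) (h : p ^ 2 - d * q ^ 2 = w) :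
    ∃ n, p = cfNum (Real.sqrt d) (n + 1) ∧ q = cfDen (Real.sqrt d) (n + 1) := by
  have hnat := Int.isCoprime_iff_gcd_eq_one.1 hcop
  set s := Real.sqrt d with hs
  have hs2 : s ^ 2 = d := Real.sq_sqrt (Nat.cast_nonneg d)
  have hpR : (0 : ℝ) < p := by exact_mod_cast hp
  have hqR : (0 : ℝ) < q := by exact_mod_cast hq
  have hwR : (0 : ℝ) < w := by exact_mod_cast hw
  have hws : (w : ℝ) < s := by
    rw [hs]
    refine Real.lt_sqrt_of_sq_lt ?_
    exact_mod_cast hwd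
  have hR : (p : ℝ) ^ 2 - s ^ 2 * q ^ 2 = w := by
    rw [hs2]
    exact_mod_cast h
  have hlt : s * q < p := by
    refine lt_of_pow_lt_pow_left₀ 2 hpR.le ?_
    rw [mul_pow]
    linarith
  have hden : (((p : ℚ) / q).den : ℤ) = q := Rat.den_div_eq_of_coprime hq hnat
  have happ : |s - (((p : ℚ) / q : ℚ) : ℝ)| < 1 / (2 * ((((p : ℚ) / q).den : ℕ) : ℝ) ^ 2) := by
    have : ((((p : ℚ) / q).den : ℕ) : ℝ) = q := by exact_mod_cast hden
    rw [this]
    push_cast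
    rw [abs_sub_comm, abs_of_pos (by rw [sub_pos, lt_div_iff₀ hqR]; exact hlt),
      lt_div_iff₀ (by positivity)]
    have e : ((p : ℝ) / q - s) * (2 * q ^ 2) = 2 * q * (p - s * q) := by field_simp
    rw [e]
    have h0 : 0 < p - s * q := by linarith
    have h1 : (p - s * q) * (p + s * q) = w := by linarith
    have hs0 : 0 < s := hwR.trans hws
    have h2 : (p - s * q) * (2 * s * q) < s := by nlinarith
    nlinarith
  obtain ⟨n, hn⟩ := Real.exists_rat_eq_convergent happ
  rw [convergent_eq_cfNum_div_cfDen E.one_le_pq_succ] at hn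
  exact ⟨n, Rat.div_int_inj hq (cfDen_nonneg E.one_le_pq_succ n).2 hnat
    (Int.isCoprime_iff_gcd_eq_one.1 (isCoprime_cfNum_cfDen _ _)) hn⟩

end SqrtExpansion

/-- Corollary 21: for `2 ≤ a < b` coprime with `a` odd,
`d = ab` not a square and `T ≡ 0 (mod 4)`, the equation `a·x² - b·y² = 1`
has a solution iff `v_N = a` where `N = T/2`. -/
theorem stmt18 (a b : ℕ) (ha2 : 2 ≤ a) (hab : a < b) (hcop : Nat.Coprime a b)
    (haodd : Odd a)
    (d : ℕ) (hdab : d = a * b) (hd : ¬ IsSquare d)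
    (aq aq' : ℕ → ℤ) (haq : ∀ n, aq n = pq (Real.sqrt d) n)
    (haq'0 : aq' 0 = 2 * aq 0) (haq' : ∀ n, 1 ≤ n → aq' n = aq n)
    (u v : ℕ → ℤ) (hu0 : u 0 = aq 0) (hv0 : v 0 = 1)
    (hupos : ∀ n, 0 < u n) (hvpos : ∀ n, 0 < v n)
    (hu : ∀ n, u (n + 1) = aq' n * v n - u n)
    (hv : ∀ n, v n * v (n + 1) = (d : ℤ) - (u (n + 1)) ^ 2)
    (T : ℕ) (hT : 1 ≤ T)
    (hper : ∀ n, 1 ≤ n → pq (Real.sqrt d) (n + T) = pq (Real.sqrt d) n)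
    (hmin : ∀ T', 1 ≤ T' →
      (∀ n, 1 ≤ n → pq (Real.sqrt d) (n + T') = pq (Real.sqrt d) n) → T ≤ T')
    (hT4 : T % 4 = 0) :
    (∃ x y : ℕ, (a : ℤ) * (x : ℤ) ^ 2 - (b : ℤ) * (y : ℤ) ^ 2 = 1) ↔
      v (T / 2) = (a : ℤ) := by
  have E : SqrtExpansion d aq' u v :=
    ⟨hd, by rw [haq'0, haq], fun n ↦ by rw [haq' _ (by omega), haq], by rw [hu0, haq], hv0, hvpos,
      hu, hv⟩
  have hdZ : (d : ℤ) = a * b := by exact_mod_cast hdab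
  obtain ⟨N, rfl⟩ : ∃ N, T = N + N := ⟨T / 2, by omega⟩
  rw [show (N + N) / 2 = N by omega]
  obtain ⟨M, rfl⟩ : ∃ M, N = M + 1 := ⟨N - 1, by omega⟩
  constructor
  · rintro ⟨x, y, hxy⟩
    have hcop' : IsCoprime ((a : ℤ) * x) y := ⟨x, -b * y, by linear_combination hxy⟩
    have haZ : (2 : ℤ) ≤ a := by exact_mod_cast ha2
    have habZ : (a : ℤ) < b := by exact_mod_cast hab
    have hx : (0 : ℤ) < x := by
      rcases Nat.eq_zero_or_pos x with rfl | h
      · exfalso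
        push_cast at hxy
        nlinarith [sq_nonneg (y : ℤ)]
      · exact_mod_cast h
    have hy : (0 : ℤ) < y := by
      rcases Nat.eq_zero_or_pos y with rfl | h
      · exfalso
        push_cast at hxy
        nlinarith
      · exact_mod_cast h
    obtain ⟨n, h1, h2⟩ := E.exists_eq_cfNum_cfDen (w := a) (mul_pos (by linarith) hx) hy hcop'
      (by linarith) (by rw [hdZ]; nlinarith) (by rw [hdZ]; linear_combination (a : ℤ) * hxy)
    have h3 := E.norm_eq (n + 1)
    have hva : v (n + 1) = a := by
      rw [← h1, ← h2, hdZ] at h3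
      have h4 : (a : ℤ) = (-1) ^ (n + 1) * v (n + 1) := by
        rw [← h3]; linear_combination -(a : ℤ) * hxy
      have := hvpos (n + 1)
      rcases neg_one_pow_eq_or ℤ (n + 1) with h | h <;> rw [h] at h4 <;> linarith
    have hdvd : v (n + 1) ∣ u (n + 1) := by
      have h4 := (E.cfNum_cfDen n).1
      rw [← h1, ← h2, hva] at h4
      rw [hva]
      refine (hcop'.of_mul_left_left).dvd_of_dvd_mul_right
        ⟨x - cfDen (Real.sqrt d) n, by linear_combination -h4⟩
    have h5 := (E.reflect (E.u_succ_eq_of_dvd hdvd) (n + 1) 0 rfl).1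
    rw [hv0] at h5
    obtain ⟨k, hk⟩ := E.period_dvd_of_v_eq_one hT hper hmin h5
    have hk' : n + 1 = (M + 1) * k := by nlinarith
    rcases Nat.even_or_odd' k with ⟨l, rfl | rfl⟩
    · have := E.v_add_mul_period hper 0 l
      rw [show 0 + l * (M + 1 + (M + 1)) = n + 1 by rw [hk']; ring, hva, hv0] at this
      omega
    · rw [← hva, ← E.v_add_mul_period hper (M + 1) l, hk']
      congr 1
      ring
  · intro hva
    have h1 := E.u_half_period_succ hper
    have hdvd : (a : ℤ) ∣ u (M + 1) := by
      have h2 := hu (M + 1)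
      rw [h1, hva] at h2
      have hc : IsCoprime (a : ℤ) 2 := by
        exact_mod_cast Nat.isCoprime_iff_coprime.2 (Nat.coprime_two_right.2 haodd)
      exact hc.dvd_of_dvd_mul_left ⟨aq' (M + 1), by linarith⟩
    have h2 := (E.cfNum_cfDen M).1
    have h3 := E.norm_eq (M + 1)
    rw [Even.neg_one_pow (by rw [Nat.even_iff]; omega), one_mul, hva, hdZ] at h3
    obtain ⟨x, hx⟩ : (a : ℤ) ∣ cfNum (Real.sqrt d) (M + 1) := by
      rw [h2, hva]
      exact dvd_add (hdvd.mul_right _) (dvd_mul_right _ _)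
    refine ⟨x.natAbs, (cfDen (Real.sqrt d) (M + 1)).natAbs, ?_⟩
    rw [Int.natAbs_sq, Int.natAbs_sq]
    rw [hx] at h3
    refine mul_left_cancel₀ (show (a : ℤ) ≠ 0 by positivity) ?_
    linear_combination h3
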